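/- Let G = ⟨s₁,...,s_r⟩ act on (X,μ). If α and β are finite generating partitions, then inf_n F(α^n) = inf_n F(β^n), where F(γ) = (1-2r)H(γ) + Σ_{i=1}^r H(γ ∨ s_iγ) and γ^n = ⋁_{g∈B(e,n)} gγ. Hence f(G,X,μ) := inf_n F(α^n) is a measure-conjugacy invariant. -/

import Mathlib

open MeasureTheory Real
open scoped symmDiff ENNReal

namespace Bowen

variable {X : Type*} [MeasurableSpace X]

/-- Shannon entropy of the (countable) partition of `X` into fibers of `α`. -/
noncomputable def entropy {ι : Type*} (μ : Measure X) (α : X → ι) : ℝ :=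
  ∑' i, Real.negMulLog (μ (α ⁻¹' {i})).toReal

/-- Conditional entropy `H(α|β)` of the fiber partition of `α` given that of `β`. -/
noncomputable def condEntropy {ι κ : Type*} (μ : Measure X) (α : X → ι) (β : X → κ) : ℝ :=
  ∑' p : ι × κ,
    -((μ (α ⁻¹' {p.1} ∩ β ⁻¹' {p.2})).toReal *
      Real.log ((μ (α ⁻¹' {p.1} ∩ β ⁻¹' {p.2})).toReal / (μ (β ⁻¹' {p.2})).toReal))

/-- The Rokhlin distance `d(α,β) = H(α|β) + H(β|α)`. -/
noncomputable def rokhlin {ι κ : Type*} (μ : Measure X) (α : X → ι) (β : X → κ) : ℝ :=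
  condEntropy μ α β + condEntropy μ β α

/-- A finite measurable partition, presented as a measurable map to `ℕ` with finite range. -/
def IsFinPart (α : X → ℕ) : Prop := Measurable α ∧ (Set.range α).Finite

/-- `α` refines `β` (mod null sets): `β` factors a.e. through `α`. -/
def RefinesI {ι κ : Type*} (μ : Measure X) (α : X → ι) (β : X → κ) : Prop :=
  ∃ h : ι → κ, ∀ᵐ x ∂μ, β x = h (α x)

/-- The join `α ∨ β` of two `ℕ`-indexed partitions, encoded via `Nat.pair`. -/
def joinN (α β : X → ℕ) : X → ℕ := fun x => Nat.pair (α x) (β x)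

/-- The translated partition `gα`, with atoms `gA = {x | g⁻¹x ∈ A}` for atoms `A` of `α`. -/
def smulPart {G : Type*} [Group G] [MulAction G X] {ι : Type*} (g : G) (α : X → ι) : X → ι :=
  fun x => α (g⁻¹ • x)

/-- Join of a list of `ℕ`-indexed partitions. -/
def joinList (l : List (X → ℕ)) : X → ℕ :=
  l.foldr (fun a r x => Nat.pair (a x) (r x)) (fun _ => 0)

/-- The join `α^F = ⋁_{g ∈ F} gα` over a finite set of group elements. -/
noncomputable def joinOver {G : Type*} [Group G] [MulAction G X] (F : Finset G) (α : X → ℕ) : X → ℕ :=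
  joinList (F.toList.map (fun g => smulPart g α))

/-- The smallest `G`-invariant σ-algebra containing the partition `α`. -/
def genSA (G : Type*) [Group G] [MulAction G X] {ι : Type*} (α : X → ι) :
    MeasurableSpace X :=
  MeasurableSpace.generateFrom {s | ∃ (g : G) (i : ι), s = {x | α (g⁻¹ • x) = i}}

/-- `α` is a generating partition: every measurable set agrees mod `μ`-null sets with a set
in the smallest `G`-invariant σ-algebra containing `α`. -/
def IsGenerating (G : Type*) [Group G] [MulAction G X] {ι : Type*} (μ : Measure X)
    (α : X → ι) : Prop :=
  ∀ s : Set X, MeasurableSet s → ∃ t : Set X, MeasurableSet[genSA G α] t ∧ μ (s ∆ t) = 0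

/-- Combinatorial equivalence: `α ≤ β^L` and `β ≤ α^M` for some finite `L, M ⊆ G`. -/
def CombEquiv (G : Type*) [Group G] [MulAction G X] (μ : Measure X) (α β : X → ℕ) : Prop :=
  ∃ L M : Finset G, RefinesI μ (joinOver L β) α ∧ RefinesI μ (joinOver M α) β

/-- `α` and `β` induce the same partition mod null sets. -/
def SamePart (μ : Measure X) (α β : X → ℕ) : Prop := RefinesI μ α β ∧ RefinesI μ β α

/-- `σ` is a simple splitting of `α`: `σ = α ∨ sβ` (as partitions, mod null sets) for some
`s ∈ S` and some coarsening `β` of `α`. -/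
def SimpleSplit {G : Type*} [Group G] [MulAction G X] (μ : Measure X) (S : Finset G)
    (σ α : X → ℕ) : Prop :=
  ∃ s ∈ S, ∃ β : X → ℕ, RefinesI μ α β ∧ SamePart μ σ (joinN α (smulPart s β))

/-- `σ` is a splitting of `α`: obtained from `α` by finitely many simple splittings. -/
def IsSplitting {G : Type*} [Group G] [MulAction G X] (μ : Measure X) (S : Finset G)
    (σ α : X → ℕ) : Prop :=
  Relation.ReflTransGen (fun a b => SimpleSplit μ S b a) α σ

/-- The ball of radius `n` about the identity for the word metric of `S`:
all products of at most `n` elements of `S`. -/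
def ballF {G : Type*} [Group G] [DecidableEq G] (S : Finset G) : ℕ → Finset G
  | 0 => {1}
  | n + 1 => ballF S n ∪ (S ×ˢ ballF S n).image (fun p => p.1 * p.2)

/-- The Cayley graph of `(G,S)` (as a simple graph). -/
def cayley {G : Type*} [Group G] (S : Finset G) : SimpleGraph G :=
  SimpleGraph.fromRel (fun g h => g⁻¹ * h ∈ S)

/-- The symmetric generating set `S = {s₁^{±1},...,s_r^{±1}}` of the rank `r` free group. -/
noncomputable def genS (r : ℕ) : Finset (FreeGroup (Fin r)) :=
  letI := Classical.decEq (FreeGroup (Fin r))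
  (Finset.univ.image fun i : Fin r => FreeGroup.of i) ∪
    (Finset.univ.image fun i : Fin r => (FreeGroup.of i)⁻¹)

/-- The word-metric ball of radius `n` about `e` in the rank `r` free group. -/
noncomputable def ballFree (r : ℕ) (n : ℕ) : Finset (FreeGroup (Fin r)) :=
  letI := Classical.decEq (FreeGroup (Fin r))
  ballF (genS r) n

/-- Bowen's functional `F(α) = (1-2r)H(α) + ∑ᵢ H(α ∨ sᵢα)`. -/
noncomputable def Ffun (r : ℕ) {X : Type*} [MeasurableSpace X]
    [MulAction (FreeGroup (Fin r)) X] (μ : Measure X) (α : X → ℕ) : ℝ :=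
  (1 - 2 * (r : ℝ)) * entropy μ α +
    ∑ i : Fin r, entropy μ (joinN α (smulPart (FreeGroup.of i) α))

/-- Conditional entropy of the partition `α` relative to a sub-σ-algebra `m`:
`H(α|m) = ∫ -log μ(A_x|m)(x) dμ(x)`. -/
noncomputable def condEntropySigma (μ : Measure X) (α : X → ℕ) (m : MeasurableSpace X) : ℝ :=
  ∫ x, -Real.log ((μ[Set.indicator (α ⁻¹' {α x}) (fun _ => (1 : ℝ))|m]) x) ∂μ

end Bowen

open Bowen

namespace Bowen

/-- A finite partition with labels in an arbitrary type. -/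
structure FinPart {X ι : Type*} [MeasurableSpace X] (f : X → ι) : Prop where
  measurableSet_fiber : ∀ i, MeasurableSet (f ⁻¹' {i})
  finite_range : (Set.range f).Finite

section Entropy

variable {X ι κ ν : Type*} [MeasurableSpace X]

namespace FinPart

lemma exists_finset {f : X → ι} (hf : FinPart f) : ∃ A : Finset ι, ∀ x, f x ∈ A :=
  ⟨hf.finite_range.toFinset, fun x => by simp⟩

lemma prodMk {f : X → ι} {g : X → κ} (hf : FinPart f) (hg : FinPart g) :
    FinPart (fun x => (f x, g x)) where
  measurableSet_fiber := by
    rintro ⟨i, j⟩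
    convert (hf.measurableSet_fiber i).inter (hg.measurableSet_fiber j) using 1
    ext x
    simp
  finite_range := by
    refine (hf.finite_range.prod hg.finite_range).subset ?_
    rintro _ ⟨x, rfl⟩
    exact ⟨⟨x, rfl⟩, ⟨x, rfl⟩⟩

lemma isFinPart {f : X → ℕ} (hf : FinPart f) : IsFinPart f :=
  ⟨measurable_to_countable' hf.measurableSet_fiber, hf.finite_range⟩

end FinPart

lemma IsFinPart.finPart {f : X → ℕ} (hf : IsFinPart f) : FinPart f :=
  ⟨fun i => hf.1 (measurableSet_singleton i), hf.2⟩

lemma entropy_eq_sum (μ : Measure X) {f : X → ι} {A : Finset ι} (hA : ∀ x, f x ∈ A) :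
    entropy μ f = ∑ i ∈ A, negMulLog (μ.real (f ⁻¹' {i})) := by
  unfold entropy
  refine tsum_eq_sum fun i hi => ?_
  have : f ⁻¹' {i} = ∅ := by
    ext x
    simp only [Set.mem_preimage, Set.mem_singleton_iff, Set.mem_empty_iff_false, iff_false]
    rintro rfl
    exact hi (hA x)
  simp [this]

lemma sum_measureReal_inter_fiber (μ : Measure X) [IsFiniteMeasure μ] {g : X → κ}
    (hg : FinPart g) {B : Finset κ} (hB : ∀ x, g x ∈ B) (s : Set X) :
    ∑ j ∈ B, μ.real (s ∩ g ⁻¹' {j}) = μ.real s := by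
  have h := sum_measureReal_preimage_singleton (μ := μ.restrict s) B (f := g)
    (fun j _ => hg.measurableSet_fiber j)
  have hu : g ⁻¹' (B : Set κ) = Set.univ := by
    ext x
    simp [hB x]
  rw [hu] at h
  simp only [measureReal_restrict_apply (hg.measurableSet_fiber _),
    measureReal_restrict_apply MeasurableSet.univ, Set.univ_inter] at h
  simpa only [Set.inter_comm] using h

lemma negMulLog_sum_le {B : Finset κ} (q : κ → ℝ) (hq : ∀ j ∈ B, 0 ≤ q j) :
    negMulLog (∑ j ∈ B, q j) ≤ ∑ j ∈ B, negMulLog (q j) := by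
  rw [negMulLog, neg_mul, Finset.sum_mul, ← Finset.sum_neg_distrib]
  refine Finset.sum_le_sum fun j hj => ?_
  rw [negMulLog, neg_mul, neg_le_neg_iff]
  rcases (hq j hj).eq_or_lt with h | h
  · simp [← h]
  · exact mul_le_mul_of_nonneg_left
      (Real.log_le_log h (Finset.single_le_sum hq hj)) h.le

lemma entropy_le_of_factorsThrough (μ : Measure X) [IsFiniteMeasure μ] {f : X → ι} {g : X → κ}
    (hf : FinPart f) (hg : FinPart g) (h : f.FactorsThrough g) :
    entropy μ f ≤ entropy μ g := by
  classical
  obtain ⟨A, hA⟩ := hf.exists_finset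
  obtain ⟨B, hB⟩ := hg.exists_finset
  rw [entropy_eq_sum μ hA, entropy_eq_sum μ hB]
  calc ∑ i ∈ A, negMulLog (μ.real (f ⁻¹' {i}))
      ≤ ∑ i ∈ A, ∑ j ∈ B, negMulLog (μ.real (f ⁻¹' {i} ∩ g ⁻¹' {j})) := by
        refine Finset.sum_le_sum fun i _ => ?_
        rw [← sum_measureReal_inter_fiber μ hg hB]
        exact negMulLog_sum_le _ fun _ _ => measureReal_nonneg
    _ = ∑ j ∈ B, ∑ i ∈ A, negMulLog (μ.real (f ⁻¹' {i} ∩ g ⁻¹' {j})) := Finset.sum_comm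
    _ = ∑ j ∈ B, negMulLog (μ.real (g ⁻¹' {j})) := by
        refine Finset.sum_congr rfl fun j _ => ?_
        by_cases hj : ∃ x, g x = j
        · obtain ⟨x, rfl⟩ := hj
          rw [Finset.sum_eq_single_of_mem (f x) (hA x)]
          · congr 2
            ext y
            simp only [Set.mem_inter_iff, Set.mem_preimage, Set.mem_singleton_iff,
              and_iff_right_iff_imp]
            exact fun hy => h hy
          · intro i _ hi
            have : f ⁻¹' {i} ∩ g ⁻¹' {g x} = ∅ := by
              ext y
              simp only [Set.mem_inter_iff, Set.mem_preimage, Set.mem_singleton_iff,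
                Set.mem_empty_iff_false, iff_false, not_and]
              rintro rfl hy
              exact hi (h hy)
            simp [this]
        · have : g ⁻¹' {j} = ∅ := by
            ext y
            simpa using fun hy => hj ⟨y, hy⟩
          simp [this]

lemma sum_negMulLog_add_le (A : Finset ι) (B : Finset κ) (q : ι → κ → ℝ)
    (hq : ∀ i j, 0 ≤ q i j) :
    ∑ i ∈ A, ∑ j ∈ B, negMulLog (q i j) + negMulLog (∑ i ∈ A, ∑ j ∈ B, q i j) ≤
      ∑ i ∈ A, negMulLog (∑ j ∈ B, q i j) + ∑ j ∈ B, negMulLog (∑ i ∈ A, q i j) := by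
  set R : ι → ℝ := fun i => ∑ j ∈ B, q i j with hR
  set C : κ → ℝ := fun j => ∑ i ∈ A, q i j with hC
  set Q : ℝ := ∑ i ∈ A, R i with hQ
  have hQC : ∑ j ∈ B, C j = Q := Finset.sum_comm
  have hR0 : ∀ i, 0 ≤ R i := fun i => Finset.sum_nonneg fun j _ => hq i j
  have hC0 : ∀ j, 0 ≤ C j := fun j => Finset.sum_nonneg fun i _ => hq i j
  have hQ0 : 0 ≤ Q := Finset.sum_nonneg fun i _ => hR0 i
  have key : ∀ i ∈ A, ∀ j ∈ B, q i j - R i * C j / Q ≤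
      q i j * log (q i j) + q i j * log Q - q i j * log (R i) - q i j * log (C j) := by
    intro i hi j hj
    rcases (hq i j).eq_or_lt with h | h
    · rw [← h]
      have : 0 ≤ R i * C j / Q := div_nonneg (mul_nonneg (hR0 i) (hC0 j)) hQ0
      simpa using this
    · have hRi : 0 < R i := h.trans_le (Finset.single_le_sum (fun j _ => hq i j) hj)
      have hCj : 0 < C j :=
        h.trans_le (Finset.single_le_sum (f := fun i => q i j) (fun i _ => hq i j) hi)
      have hQp : 0 < Q := hRi.trans_le (Finset.single_le_sum (fun i _ => hR0 i) hi)
      have hl := Real.one_sub_inv_le_log_of_pos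
        (div_pos (mul_pos h hQp) (mul_pos hRi hCj))
      rw [Real.log_div (mul_pos h hQp).ne' (mul_pos hRi hCj).ne',
        Real.log_mul h.ne' hQp.ne', Real.log_mul hRi.ne' hCj.ne'] at hl
      have := mul_le_mul_of_nonneg_left hl h.le
      have e : q i j * (1 - (q i j * Q / (R i * C j))⁻¹) = q i j - R i * C j / Q := by
        field_simp
      rw [e] at this
      linarith
  have hsum := Finset.sum_le_sum fun i hi => Finset.sum_le_sum (key i hi)
  have hleft : ∑ i ∈ A, ∑ j ∈ B, (q i j - R i * C j / Q) = 0 := by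
    simp only [Finset.sum_sub_distrib, ← Finset.sum_div, ← Finset.mul_sum, ← Finset.sum_mul,
      hQC]
    change Q - Q * Q / Q = 0
    by_cases h : Q = 0
    · simp [h]
    · field_simp
      simp
  have h1 : ∑ i ∈ A, ∑ j ∈ B, q i j * log Q = Q * log Q := by
    simp only [← Finset.sum_mul]
    rfl
  have h2 : ∑ i ∈ A, ∑ j ∈ B, q i j * log (R i) = ∑ i ∈ A, R i * log (R i) := by
    simp only [← Finset.sum_mul]
    rfl
  have h3 : ∑ i ∈ A, ∑ j ∈ B, q i j * log (C j) = ∑ j ∈ B, C j * log (C j) := by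
    rw [Finset.sum_comm]
    simp only [← Finset.sum_mul]
    rfl
  rw [hleft] at hsum
  simp only [Finset.sum_sub_distrib, Finset.sum_add_distrib, h1, h2, h3] at hsum
  simp only [negMulLog, neg_mul, Finset.sum_neg_distrib]
  linarith

/-- Submodularity of Shannon entropy. -/
lemma entropy_submodular (μ : Measure X) [IsFiniteMeasure μ] {f : X → ι} {g : X → κ}
    {k : X → ν} (hf : FinPart f) (hg : FinPart g) (hk : FinPart k) :
    entropy μ (fun x => (f x, g x, k x)) + entropy μ k ≤
      entropy μ (fun x => (f x, k x)) + entropy μ (fun x => (g x, k x)) := by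
  classical
  obtain ⟨A, hA⟩ := hf.exists_finset
  obtain ⟨B, hB⟩ := hg.exists_finset
  obtain ⟨C, hC⟩ := hk.exists_finset
  rw [entropy_eq_sum μ (A := A ×ˢ B ×ˢ C) (by simp [hA, hB, hC]), entropy_eq_sum μ hC,
    entropy_eq_sum μ (A := A ×ˢ C) (by simp [hA, hC]),
    entropy_eq_sum μ (A := B ×ˢ C) (by simp [hB, hC])]
  simp only [Finset.sum_product_right]
  rw [← Finset.sum_add_distrib, ← Finset.sum_add_distrib]
  refine Finset.sum_le_sum fun c _ => ?_
  have hfg : ∀ a b, (fun x => (f x, g x, k x)) ⁻¹' {(a, b, c)} =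
      k ⁻¹' {c} ∩ f ⁻¹' {a} ∩ g ⁻¹' {b} := by
    intro a b
    ext x
    simp only [Set.mem_preimage, Set.mem_singleton_iff, Prod.mk.injEq, Set.mem_inter_iff]
    tauto
  have hfk : ∀ a, (fun x => (f x, k x)) ⁻¹' {(a, c)} = k ⁻¹' {c} ∩ f ⁻¹' {a} := by
    intro a
    ext x
    simp [and_comm]
  have hgk : ∀ b, (fun x => (g x, k x)) ⁻¹' {(b, c)} = k ⁻¹' {c} ∩ g ⁻¹' {b} := by
    intro b
    ext x
    simp [and_comm]
  have hrow : ∀ a, ∑ b ∈ B, μ.real (k ⁻¹' {c} ∩ f ⁻¹' {a} ∩ g ⁻¹' {b}) =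
      μ.real (k ⁻¹' {c} ∩ f ⁻¹' {a}) := fun a => sum_measureReal_inter_fiber μ hg hB _
  have hcol : ∀ b, ∑ a ∈ A, μ.real (k ⁻¹' {c} ∩ f ⁻¹' {a} ∩ g ⁻¹' {b}) =
      μ.real (k ⁻¹' {c} ∩ g ⁻¹' {b}) := by
    intro b
    simp only [Set.inter_right_comm _ _ (g ⁻¹' {b})]
    exact sum_measureReal_inter_fiber μ hf hA _
  have hmain := sum_negMulLog_add_le A B
    (fun a b => μ.real (k ⁻¹' {c} ∩ f ⁻¹' {a} ∩ g ⁻¹' {b})) fun _ _ => measureReal_nonneg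
  simp only [hrow, hcol, sum_measureReal_inter_fiber μ hf hA] at hmain
  simp only [hfg, hfk, hgk]
  rw [Finset.sum_comm]
  exact hmain

/-- Submodularity of Shannon entropy with respect to the order on partitions. -/
lemma entropy_add_le {ω : Type*} (μ : Measure X) [IsFiniteMeasure μ] {f : X → ι} {g : X → κ}
    {k : X → ν} {w : X → ω} (hf : FinPart f) (hg : FinPart g) (hk : FinPart k) (hw : FinPart w)
    (hkf : k.FactorsThrough f) (hkg : k.FactorsThrough g)
    (hwfg : ∀ x y, f x = f y → g x = g y → w x = w y) :
    entropy μ w + entropy μ k ≤ entropy μ f + entropy μ g := by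
  have h1 : entropy μ w ≤ entropy μ (fun x => (f x, g x, k x)) :=
    entropy_le_of_factorsThrough μ hw (hf.prodMk (hg.prodMk hk)) fun x y hxy => by
      simp only [Prod.mk.injEq] at hxy
      exact hwfg x y hxy.1 hxy.2.1
  have h2 : entropy μ (fun x => (f x, k x)) ≤ entropy μ f :=
    entropy_le_of_factorsThrough μ (hf.prodMk hk) hf fun x y hxy => by
      simp [hxy, hkf hxy]
  have h3 : entropy μ (fun x => (g x, k x)) ≤ entropy μ g :=
    entropy_le_of_factorsThrough μ (hg.prodMk hk) hg fun x y hxy => by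
      simp [hxy, hkg hxy]
  linarith [entropy_submodular μ hf hg hk]

end Entropy

section Joins

variable {X : Type*}

lemma joinN_eq_joinN {α β : X → ℕ} {x y : X} :
    joinN α β x = joinN α β y ↔ α x = α y ∧ β x = β y := Nat.pair_eq_pair

lemma joinList_eq_joinList {l : List (X → ℕ)} {x y : X} :
    joinList l x = joinList l y ↔ ∀ α ∈ l, α x = α y := by
  induction l with
  | nil => simp [joinList]
  | cons a l ih =>
    rw [List.forall_mem_cons, ← ih]
    exact Nat.pair_eq_pair

lemma joinOver_eq_joinOver {G : Type*} [Group G] [MulAction G X] {F : Finset G} {α : X → ℕ}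
    {x y : X} :
    joinOver F α x = joinOver F α y ↔ ∀ g ∈ F, α (g⁻¹ • x) = α (g⁻¹ • y) := by
  simp [joinOver, joinList_eq_joinList, smulPart]

variable [MeasurableSpace X]

lemma FinPart.joinN {α β : X → ℕ} (hα : FinPart α) (hβ : FinPart β) : FinPart (joinN α β) where
  measurableSet_fiber i :=
    (measurable_of_countable (fun p : ℕ × ℕ => Nat.pair p.1 p.2)).comp
      (hα.isFinPart.1.prodMk hβ.isFinPart.1) (measurableSet_singleton i)
  finite_range := by
    refine ((hα.finite_range.prod hβ.finite_range).image (fun p => Nat.pair p.1 p.2)).subset ?_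
    rintro _ ⟨x, rfl⟩
    exact ⟨(α x, β x), ⟨⟨x, rfl⟩, ⟨x, rfl⟩⟩, rfl⟩

lemma FinPart.const {ι : Type*} (c : ι) : FinPart (fun _ : X => c) where
  measurableSet_fiber i := MeasurableSet.const (c = i)
  finite_range := (Set.finite_singleton c).subset Set.range_const_subset

lemma FinPart.joinList {l : List (X → ℕ)} (hl : ∀ α ∈ l, FinPart α) : FinPart (joinList l) := by
  induction l with
  | nil => exact FinPart.const 0
  | cons a l ih =>
    rw [List.forall_mem_cons] at hl
    exact hl.1.joinN (ih hl.2)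

variable {G : Type*} [Group G] [MulAction G X]

lemma FinPart.smulPart {ι : Type*} {α : X → ι} (hα : FinPart α) {g : G}
    (hg : Measurable fun x : X => g⁻¹ • x) : FinPart (smulPart g α) where
  measurableSet_fiber i := hg (hα.measurableSet_fiber i)
  finite_range := hα.finite_range.subset (Set.range_comp_subset_range _ α)

lemma FinPart.joinOver {α : X → ℕ} (hα : FinPart α)
    (hG : ∀ g : G, Measurable fun x : X => g • x) (F : Finset G) : FinPart (joinOver F α) := by
  refine FinPart.joinList fun β hβ => ?_
  obtain ⟨g, -, rfl⟩ := List.mem_map.1 hβ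
  exact hα.smulPart (hG _)

lemma entropy_smulPart {ι : Type*} {μ : Measure X} {α : X → ι} (hα : FinPart α) {g : G}
    (hg : MeasurePreserving (fun x : X => g⁻¹ • x) μ μ) :
    entropy μ (smulPart g α) = entropy μ α := by
  unfold entropy
  congr 1 with i
  congr 2
  exact hg.measure_preimage (hα.measurableSet_fiber i).nullMeasurableSet

end Joins

section Splitting

variable {X : Type*} [MeasurableSpace X] {r : ℕ} [MulAction (FreeGroup (Fin r)) X]
  {μ : Measure X} [IsProbabilityMeasure μ]

lemma mem_genS {s : FreeGroup (Fin r)} :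
    s ∈ genS r ↔ ∃ i, s = FreeGroup.of i ∨ s = (FreeGroup.of i)⁻¹ := by
  classical
  simp only [genS, Finset.mem_union, Finset.mem_image, Finset.mem_univ, true_and, exists_or,
    eq_comm]

/-- Refining a partition raises each join `γ ∨ sγ` by at most twice the entropy gained. -/
lemma entropy_joinN_smulPart_le
    (hmp : ∀ g : FreeGroup (Fin r), MeasurePreserving (fun x : X => g • x) μ μ)
    {α σ : X → ℕ} (hα : FinPart α) (hσ : FinPart σ) (h : α.FactorsThrough σ)
    (g : FreeGroup (Fin r)) :
    entropy μ (joinN σ (smulPart g σ)) ≤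
      entropy μ (joinN α (smulPart g α)) + 2 * (entropy μ σ - entropy μ α) := by
  have hgα : FinPart (smulPart g α) := hα.smulPart (hmp _).measurable
  have hgσ : FinPart (smulPart g σ) := hσ.smulPart (hmp _).measurable
  have h1 := entropy_add_le μ (hα.joinN hgσ) hσ hα (hσ.joinN hgσ)
    (fun x y hxy => (joinN_eq_joinN.1 hxy).1) h
    (fun x y hxy hxy' => joinN_eq_joinN.2 ⟨hxy', (joinN_eq_joinN.1 hxy).2⟩)
  have h2 := entropy_add_le μ (hα.joinN hgα) hgσ hgα (hα.joinN hgσ)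
    (fun x y hxy => (joinN_eq_joinN.1 hxy).2) (fun x y hxy => h hxy)
    (fun x y hxy hxy' => joinN_eq_joinN.2 ⟨(joinN_eq_joinN.1 hxy).1, hxy'⟩)
  rw [entropy_smulPart hα (hmp _), entropy_smulPart hσ (hmp _)] at h2
  linarith

lemma entropy_joinN_smulPart_mono
    (hmp : ∀ g : FreeGroup (Fin r), MeasurePreserving (fun x : X => g • x) μ μ)
    {α σ : X → ℕ} (hα : FinPart α) (hσ : FinPart σ) (h : α.FactorsThrough σ)
    (g : FreeGroup (Fin r)) :
    entropy μ (joinN α (smulPart g α)) ≤ entropy μ (joinN σ (smulPart g σ)) := by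
  refine entropy_le_of_factorsThrough μ (hα.joinN (hα.smulPart (hmp _).measurable))
    (hσ.joinN (hσ.smulPart (hmp _).measurable)) fun x y hxy => ?_
  rw [joinN_eq_joinN] at hxy ⊢
  exact ⟨h hxy.1, h hxy.2⟩

lemma Ffun_le_add
    (hmp : ∀ g : FreeGroup (Fin r), MeasurePreserving (fun x : X => g • x) μ μ)
    {α σ : X → ℕ} (hα : FinPart α) (hσ : FinPart σ) (h : α.FactorsThrough σ) :
    Ffun r μ σ ≤ Ffun r μ α + (entropy μ σ - entropy μ α) := by
  have := Finset.sum_le_sum fun (i : Fin r) (_ : i ∈ Finset.univ) =>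
    entropy_joinN_smulPart_le hmp hα hσ h (FreeGroup.of i)
  rw [Finset.sum_add_distrib, Finset.sum_const, Finset.card_univ, Fintype.card_fin,
    nsmul_eq_mul] at this
  unfold Ffun
  linarith

lemma Ffun_le_add_mul
    (hmp : ∀ g : FreeGroup (Fin r), MeasurePreserving (fun x : X => g • x) μ μ)
    {α σ : X → ℕ} (hα : FinPart α) (hσ : FinPart σ) (h : α.FactorsThrough σ) :
    Ffun r μ α ≤ Ffun r μ σ + (2 * r - 1) * (entropy μ σ - entropy μ α) := by
  have := Finset.sum_le_sum fun (i : Fin r) (_ : i ∈ Finset.univ) =>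
    entropy_joinN_smulPart_mono hmp hα hσ h (FreeGroup.of i)
  unfold Ffun
  linarith

lemma Ffun_congr
    (hmp : ∀ g : FreeGroup (Fin r), MeasurePreserving (fun x : X => g • x) μ μ)
    {α σ : X → ℕ} (hα : FinPart α) (hσ : FinPart σ) (h : α.FactorsThrough σ)
    (h' : σ.FactorsThrough α) :
    Ffun r μ α = Ffun r μ σ := by
  have he : entropy μ α = entropy μ σ :=
    (entropy_le_of_factorsThrough μ hα hσ h).antisymm (entropy_le_of_factorsThrough μ hσ hα h')
  refine le_antisymm ?_ ?_
  · simpa [he] using Ffun_le_add hmp hσ hα h'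
  · simpa [he] using Ffun_le_add hmp hα hσ h

/-- `F` does not increase under a simple splitting. -/
lemma Ffun_le_of_simple_splitting
    (hmp : ∀ g : FreeGroup (Fin r), MeasurePreserving (fun x : X => g • x) μ μ)
    {α β σ : X → ℕ} (hα : FinPart α) (hσ : FinPart σ) {s : FreeGroup (Fin r)}
    (hs : s ∈ genS r) (hβα : β.FactorsThrough α) (hασ : α.FactorsThrough σ)
    (hσα : ∀ x y, α x = α y → smulPart s β x = smulPart s β y → σ x = σ y)
    (hβσ : (smulPart s β).FactorsThrough σ) :
    Ffun r μ σ ≤ Ffun r μ α := by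
  obtain ⟨i₀, hi₀⟩ := mem_genS.1 hs
  have hspecial : entropy μ (joinN σ (smulPart (FreeGroup.of i₀) σ)) ≤
      entropy μ (joinN α (smulPart (FreeGroup.of i₀) α)) + (entropy μ σ - entropy μ α) := by
    have htα : FinPart (smulPart (FreeGroup.of i₀) α) := hα.smulPart (hmp _).measurable
    have htσ : FinPart (smulPart (FreeGroup.of i₀) σ) := hσ.smulPart (hmp _).measurable
    rcases hi₀ with rfl | rfl
    · have h := entropy_add_le μ (hα.joinN htα) htσ htα (hσ.joinN htσ)
        (fun x y hxy => (joinN_eq_joinN.1 hxy).2) (fun x y hxy => hασ hxy)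
        (fun x y hxy hxy' => by
          rw [joinN_eq_joinN] at hxy ⊢
          exact ⟨hσα x y hxy.1 (hβα hxy.2), hxy'⟩)
      rw [entropy_smulPart hα (hmp _), entropy_smulPart hσ (hmp _)] at h
      linarith
    · have h := entropy_add_le μ (hα.joinN htα) hσ hα (hσ.joinN htσ)
        (fun x y hxy => (joinN_eq_joinN.1 hxy).1) hασ
        (fun x y hxy hxy' => by
          rw [joinN_eq_joinN] at hxy ⊢
          refine ⟨hxy', hσα _ _ hxy.2 ?_⟩
          simpa [smulPart] using hβα hxy.1)
      linarith
  have hsum := Finset.sum_le_sum fun (i : Fin r) (_ : i ∈ Finset.univ) =>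
    show entropy μ (joinN σ (smulPart (FreeGroup.of i) σ)) ≤
      entropy μ (joinN α (smulPart (FreeGroup.of i) α)) + 2 * (entropy μ σ - entropy μ α) -
        (if i = i₀ then entropy μ σ - entropy μ α else 0) by
      split_ifs with hi
      · subst hi
        linarith
      · simpa using entropy_joinN_smulPart_le hmp hα hσ hασ (FreeGroup.of i)
  rw [Finset.sum_sub_distrib, Finset.sum_add_distrib, Finset.sum_const, Finset.card_univ,
    Fintype.card_fin, nsmul_eq_mul, Finset.sum_ite_eq' _ i₀, if_pos (Finset.mem_univ _)] at hsum
  unfold Ffun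
  linarith

open scoped Classical in
lemma Ffun_joinN_joinOver_union_le
    (hmp : ∀ g : FreeGroup (Fin r), MeasurePreserving (fun x : X => g • x) μ μ)
    {ρ α : X → ℕ} (hρ : FinPart ρ) (hα : FinPart α) (F : Finset (FreeGroup (Fin r)))
    (T : Finset (FreeGroup (Fin r))) (hT : ∀ g ∈ T, ∃ s ∈ genS r, ∃ h ∈ F, g = s * h) :
    Ffun r μ (joinN ρ (joinOver (F ∪ T) α)) ≤ Ffun r μ (joinN ρ (joinOver F α)) := by
  induction T using Finset.induction_on with
  | empty => simp
  | insert g T _ ih =>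
    rw [Finset.forall_mem_insert] at hT
    obtain ⟨⟨s, hs, h, hh, rfl⟩, hT⟩ := hT
    have hG : ∀ g : FreeGroup (Fin r), Measurable fun x : X => g • x := fun g =>
      (hmp g).measurable
    refine le_trans (Ffun_le_of_simple_splitting hmp (hρ.joinN (hα.joinOver hG _))
      (hρ.joinN (hα.joinOver hG _)) hs (β := smulPart h α) ?_ ?_ ?_ ?_) (ih hT)
    all_goals
      intro x y
      simp only [joinN_eq_joinN, joinOver_eq_joinOver, smulPart, Finset.mem_union,
        Finset.mem_insert]
    · exact fun hxy => hxy.2 h (.inl hh)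
    · exact fun hxy => ⟨hxy.1, fun g hg => hxy.2 g (by tauto)⟩
    · rintro ⟨h1, h2⟩ h3
      refine ⟨h1, fun g hg => ?_⟩
      by_cases hgs : g = s * h
      · subst hgs
        simpa [mul_smul] using h3
      · exact h2 g (by tauto)
    · intro hxy
      simpa [mul_smul] using hxy.2 (s * h) (by tauto)

lemma mem_ballFree_succ {n : ℕ} {g : FreeGroup (Fin r)} : g ∈ ballFree r (n + 1) ↔
    g ∈ ballFree r n ∨ ∃ s ∈ genS r, ∃ h ∈ ballFree r n, g = s * h := by
  simp only [ballFree, ballF, Finset.mem_union, Finset.mem_image, Finset.mem_product, Prod.exists]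
  refine or_congr_right ⟨?_, ?_⟩
  · rintro ⟨s, h, ⟨hs, hh⟩, rfl⟩
    exact ⟨s, hs, h, hh, rfl⟩
  · rintro ⟨s, hs, h, hh, rfl⟩
    exact ⟨s, h, ⟨hs, hh⟩, rfl⟩

lemma ballFree_mono (r : ℕ) : Monotone (ballFree r) :=
  monotone_nat_of_le_succ fun _ _ hg => mem_ballFree_succ.2 (.inl hg)

lemma exists_mem_ballFree (g : FreeGroup (Fin r)) : ∃ n, g ∈ ballFree r n := by
  suffices h : ∀ L : List (Fin r × Bool), ∃ n, FreeGroup.mk L ∈ ballFree r n by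
    simpa only [FreeGroup.mk_toWord] using h g.toWord
  intro L
  induction L with
  | nil => exact ⟨0, Finset.mem_singleton_self _⟩
  | cons a L ih =>
    obtain ⟨n, hn⟩ := ih
    refine ⟨n + 1, mem_ballFree_succ.2 (.inr ⟨FreeGroup.mk [a], mem_genS.2 ⟨a.1, ?_⟩, _, hn,
      (FreeGroup.mul_mk (L₁ := [a]) (L₂ := L)).symm⟩)⟩
    obtain ⟨i, b⟩ := a
    cases b
    · exact .inr (by simp [FreeGroup.of, FreeGroup.inv_mk, FreeGroup.invRev])
    · exact .inl rfl

lemma Ffun_joinN_joinOver_ballFree_antitone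
    (hmp : ∀ g : FreeGroup (Fin r), MeasurePreserving (fun x : X => g • x) μ μ)
    {ρ α : X → ℕ} (hρ : FinPart ρ) (hα : FinPart α) :
    Antitone fun n => Ffun r μ (joinN ρ (joinOver (ballFree r n) α)) := by
  classical
  refine antitone_nat_of_succ_le fun n => ?_
  rw [← Finset.union_sdiff_of_subset (ballFree_mono r n.le_succ)]
  refine Ffun_joinN_joinOver_union_le hmp hρ hα _ _ fun g hg => ?_
  rw [Finset.mem_sdiff] at hg
  exact (mem_ballFree_succ.1 hg.1).resolve_left hg.2

lemma Ffun_joinOver_ballFree_antitone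
    (hmp : ∀ g : FreeGroup (Fin r), MeasurePreserving (fun x : X => g • x) μ μ)
    {α : X → ℕ} (hα : FinPart α) :
    Antitone fun n => Ffun r μ (joinOver (ballFree r n) α) := by
  have hG : ∀ n, FinPart (joinOver (ballFree r n) α) := fun n =>
    hα.joinOver (fun g => (hmp g).measurable) _
  have h0 : FinPart (fun _ : X => 0) := FinPart.const 0
  have h : ∀ n, Ffun r μ (joinOver (ballFree r n) α) =
      Ffun r μ (joinN (fun _ => 0) (joinOver (ballFree r n) α)) := fun n =>
    Ffun_congr hmp (hG n) (h0.joinN (hG n)) (fun x y hxy => (joinN_eq_joinN.1 hxy).2)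
      (fun x y hxy => joinN_eq_joinN.2 ⟨rfl, hxy⟩)
  simp only [h]
  exact Ffun_joinN_joinOver_ballFree_antitone hmp h0 hα

end Splitting

section Generating

variable {X : Type*} {r : ℕ} [MulAction (FreeGroup (Fin r)) X]

lemma joinOver_ballFree_factorsThrough (α : X → ℕ) {m n : ℕ} (h : m ≤ n) :
    (joinOver (ballFree r m) α).FactorsThrough (joinOver (ballFree r n) α) := by
  intro x y hxy
  rw [joinOver_eq_joinOver] at hxy ⊢
  exact fun g hg => hxy g (ballFree_mono r h hg)

lemma measurableSet_genSA_of_saturated {α : X → ℕ} {n : ℕ} {E : Set X}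
    (hE : ∀ x y, joinOver (ballFree r n) α x = joinOver (ballFree r n) α y → (x ∈ E ↔ y ∈ E)) :
    MeasurableSet[genSA (FreeGroup (Fin r)) α] E := by
  let _ : MeasurableSpace X := genSA (FreeGroup (Fin r)) α
  have hfiber : ∀ k, MeasurableSet (joinOver (ballFree r n) α ⁻¹' {k}) := by
    intro k
    rcases (joinOver (ballFree r n) α ⁻¹' {k}).eq_empty_or_nonempty with h | ⟨x, rfl⟩
    · rw [h]
      exact MeasurableSet.empty
    · have : joinOver (ballFree r n) α ⁻¹' {joinOver (ballFree r n) α x} =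
          ⋂ g ∈ ballFree r n, {y | α (g⁻¹ • y) = α (g⁻¹ • x)} := by
        ext y
        simp [joinOver_eq_joinOver]
      rw [this]
      exact Finset.measurableSet_biInter _ fun g _ =>
        MeasurableSpace.measurableSet_generateFrom ⟨g, _, rfl⟩
  have : E = ⋃ k ∈ joinOver (ballFree r n) α '' E, joinOver (ballFree r n) α ⁻¹' {k} := by
    ext x
    simp only [Set.mem_image, Set.iUnion_exists, Set.mem_iUnion, Set.mem_preimage,
      Set.mem_singleton_iff, exists_prop]
    constructor
    · exact fun hx => ⟨_, x, ⟨hx, rfl⟩, rfl⟩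
    · rintro ⟨_, y, ⟨hy, rfl⟩, hxy⟩
      exact (hE _ _ hxy).2 hy
  rw [this]
  exact MeasurableSet.biUnion (Set.to_countable _) fun k _ => hfiber k

lemma isSetAlgebra_saturated (r : ℕ) [MulAction (FreeGroup (Fin r)) X] (α : X → ℕ) :
    IsSetAlgebra {E : Set X | ∃ n, ∀ x y,
      joinOver (ballFree r n) α x = joinOver (ballFree r n) α y → (x ∈ E ↔ y ∈ E)} where
  empty_mem := ⟨0, fun _ _ _ => Iff.rfl⟩
  compl_mem := by
    rintro s ⟨n, hn⟩
    exact ⟨n, fun x y hxy => not_congr (hn x y hxy)⟩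
  union_mem := by
    rintro s t ⟨m, hm⟩ ⟨n, hn⟩
    exact ⟨max m n, fun x y hxy => or_congr
      (hm x y (joinOver_ballFree_factorsThrough α (le_max_left m n) hxy))
      (hn x y (joinOver_ballFree_factorsThrough α (le_max_right m n) hxy))⟩

variable [MeasurableSpace X] {μ : Measure X} [IsProbabilityMeasure μ]

/-- Measurable sets are approximated by unions of atoms of `α^n` when `α` is generating. -/
lemma exists_saturated_approx
    (hmp : ∀ g : FreeGroup (Fin r), MeasurePreserving (fun x : X => g • x) μ μ)
    {α : X → ℕ} (hα : FinPart α) (hgen : IsGenerating (FreeGroup (Fin r)) μ α) {B : Set X}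
    (hB : MeasurableSet B) {δ : ℝ} (hδ : 0 < δ) :
    ∃ n, ∃ E : Set X, MeasurableSet E ∧
      (∀ x y, joinOver (ballFree r n) α x = joinOver (ballFree r n) α y → (x ∈ E ↔ y ∈ E)) ∧
      μ.real (symmDiff B E) < δ := by
  have hle : genSA (FreeGroup (Fin r)) α ≤ ‹MeasurableSpace X› := by
    refine MeasurableSpace.generateFrom_le ?_
    rintro _ ⟨g, i, rfl⟩
    exact (hmp g⁻¹).measurable (hα.measurableSet_fiber i)
  obtain ⟨t, ht, hBt⟩ := hgen B hB
  have hgenFrom : genSA (FreeGroup (Fin r)) α =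
      MeasurableSpace.generateFrom {E : Set X | ∃ n, ∀ x y,
        joinOver (ballFree r n) α x = joinOver (ballFree r n) α y → (x ∈ E ↔ y ∈ E)} := by
    apply le_antisymm
    · refine MeasurableSpace.generateFrom_le ?_
      rintro _ ⟨g, i, rfl⟩
      obtain ⟨n, hn⟩ := exists_mem_ballFree g
      refine MeasurableSpace.measurableSet_generateFrom ⟨n, fun x y hxy => ?_⟩
      simp only [Set.mem_ofPred_eq, joinOver_eq_joinOver.1 hxy g hn]
    · exact MeasurableSpace.generateFrom_le fun E ⟨n, hE⟩ => measurableSet_genSA_of_saturated hE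
  have hdense := @Measure.MeasureDense.of_generateFrom_isSetAlgebra_finite X
    (genSA (FreeGroup (Fin r)) α) (μ.trim hle) _ _ (isSetAlgebra_saturated r α) hgenFrom
  obtain ⟨E, ⟨n, hE⟩, hlt⟩ := @Measure.MeasureDense.approx X
    (genSA (FreeGroup (Fin r)) α) _ _ hdense t ht (measure_ne_top _ _) δ hδ
  have hEm := measurableSet_genSA_of_saturated hE
  rw [trim_measurableSet_eq hle (@MeasurableSet.symmDiff X (genSA (FreeGroup (Fin r)) α) _ _ ht hEm)] at hlt
  refine ⟨n, E, hle _ hEm, hE, ?_⟩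
  have hBE : μ (symmDiff B E) < ENNReal.ofReal δ :=
    ((measure_mono (symmDiff_triangle B t E)).trans (measure_union_le _ _)).trans_lt
      (by simpa [hBt] using hlt)
  rw [measureReal_def]
  exact (ENNReal.lt_ofReal_iff_toReal_lt (measure_ne_top _ _)).1 hBE

lemma finPart_mem {B : Set X} (hB : MeasurableSet B) : FinPart (fun x => x ∈ B) where
  measurableSet_fiber _ := (measurable_mem.2 hB) (MeasurableSet.of_discrete)
  finite_range := Set.toFinite _

lemma entropy_mem {B : Set X} (hB : MeasurableSet B) :
    entropy μ (fun x => x ∈ B) = negMulLog (μ.real B) + negMulLog (1 - μ.real B) := by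
  classical
  rw [entropy_eq_sum μ (A := {True, False}) (fun x => by by_cases h : x ∈ B <;> simp [h]),
    Finset.sum_pair (by simp)]
  congr 2
  · congr 1
    ext x
    simp
  · rw [← probReal_compl_eq_one_sub hB]
    congr 1
    ext x
    simp

/-- The conditional entropy `H(f|α^n)` tends to zero. -/
def AsymptoticallyDetermined (μ : Measure X) (α : X → ℕ) {ι : Type*} (f : X → ι) : Prop :=
  ∀ ε : ℝ, 0 < ε → ∃ N, ∀ n ≥ N,
    entropy μ (fun x => (f x, joinOver (ballFree r n) α x)) <
      entropy μ (joinOver (ballFree r n) α) + ε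

namespace AsymptoticallyDetermined

variable {ι κ : Type*} {α : X → ℕ} {f : X → ι} {g : X → κ}

lemma of_factorsThrough
    (hmp : ∀ g : FreeGroup (Fin r), MeasurePreserving (fun x : X => g • x) μ μ)
    (hα : FinPart α) (hf : FinPart f) (hg : FinPart g)
    (h : AsymptoticallyDetermined (r := r) μ α f) (hgf : g.FactorsThrough f) :
    AsymptoticallyDetermined (r := r) μ α g := by
  intro ε hε
  obtain ⟨N, hN⟩ := h ε hε
  refine ⟨N, fun n hn => (entropy_le_of_factorsThrough μ ?_ ?_ ?_).trans_lt (hN n hn)⟩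
  · exact hg.prodMk (hα.joinOver (fun g => (hmp g).measurable) _)
  · exact hf.prodMk (hα.joinOver (fun g => (hmp g).measurable) _)
  · intro x y hxy
    rw [Prod.mk.injEq] at hxy ⊢
    exact ⟨hgf hxy.1, hxy.2⟩

lemma prodMk
    (hmp : ∀ g : FreeGroup (Fin r), MeasurePreserving (fun x : X => g • x) μ μ)
    (hα : FinPart α) (hf : FinPart f) (hg : FinPart g)
    (h : AsymptoticallyDetermined (r := r) μ α f) (h' : AsymptoticallyDetermined (r := r) μ α g) :
    AsymptoticallyDetermined (r := r) μ α (fun x => (f x, g x)) := by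
  intro ε hε
  obtain ⟨N, hN⟩ := h (ε / 2) (half_pos hε)
  obtain ⟨N', hN'⟩ := h' (ε / 2) (half_pos hε)
  refine ⟨max N N', fun n hn => ?_⟩
  have hγ : FinPart (joinOver (ballFree r n) α) := hα.joinOver (fun g => (hmp g).measurable) _
  have hsub := entropy_add_le μ (hf.prodMk hγ) (hg.prodMk hγ) hγ ((hf.prodMk hg).prodMk hγ)
    (fun x y hxy => (Prod.mk.inj hxy).2) (fun x y hxy => (Prod.mk.inj hxy).2)
    (fun x y hxy hxy' => by simp_all)
  linarith [hN n (le_of_max_le_left hn), hN' n (le_of_max_le_right hn)]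

lemma const (c : ι)
    (hmp : ∀ g : FreeGroup (Fin r), MeasurePreserving (fun x : X => g • x) μ μ)
    (hα : FinPart α) : AsymptoticallyDetermined (r := r) μ α (fun _ => c) := by
  intro ε hε
  refine ⟨0, fun n _ => ?_⟩
  have hγ : FinPart (joinOver (ballFree r n) α) := hα.joinOver (fun g => (hmp g).measurable) _
  have := entropy_le_of_factorsThrough μ ((FinPart.const c).prodMk hγ) hγ
    (fun x y hxy => by simp [hxy])
  linarith

lemma mem
    (hmp : ∀ g : FreeGroup (Fin r), MeasurePreserving (fun x : X => g • x) μ μ)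
    (hα : FinPart α) (hgen : IsGenerating (FreeGroup (Fin r)) μ α) {B : Set X}
    (hB : MeasurableSet B) : AsymptoticallyDetermined (r := r) μ α (fun x => x ∈ B) := by
  intro ε hε
  have hcont : Continuous fun t : ℝ => negMulLog t + negMulLog (1 - t) := by fun_prop
  obtain ⟨δ, hδ, hsmall⟩ := Metric.continuousAt_iff.1 (hcont.continuousAt (x := 0)) ε hε
  obtain ⟨N, E, hE, hsat, hlt⟩ := exists_saturated_approx hmp hα hgen hB hδ
  refine ⟨N, fun n hn => ?_⟩
  have hγ : FinPart (joinOver (ballFree r n) α) := hα.joinOver (fun g => (hmp g).measurable) _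
  have hD : MeasurableSet (symmDiff B E) := hB.symmDiff hE
  have hDε : entropy μ (fun x => x ∈ symmDiff B E) < ε := by
    rw [entropy_mem hD]
    have := hsmall (x := μ.real (symmDiff B E))
      (by rwa [Real.dist_eq, sub_zero, abs_of_nonneg measureReal_nonneg])
    simp only [Real.dist_eq, negMulLog_zero, sub_zero, negMulLog_one, add_zero] at this
    exact (le_abs_self _).trans_lt this
  have hsub := entropy_add_le μ (finPart_mem hD) hγ (FinPart.const ()) ((finPart_mem hB).prodMk hγ)
    (fun x y _ => rfl) (fun x y _ => rfl) (fun x y hxy hxy' => by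
      have h := hsat x y (joinOver_ballFree_factorsThrough α hn hxy')
      simp only [Set.mem_symmDiff, eq_iff_iff] at hxy
      simp only [Prod.mk.injEq, eq_iff_iff]
      exact ⟨by tauto, hxy'⟩)
  have hconst : entropy μ (fun _ : X => ()) = 0 := by
    simp [entropy_eq_sum μ (f := fun _ : X => ()) (A := {()}) (by simp)]
  linarith

lemma of_isGenerating
    (hmp : ∀ g : FreeGroup (Fin r), MeasurePreserving (fun x : X => g • x) μ μ)
    (hα : FinPart α) (hgen : IsGenerating (FreeGroup (Fin r)) μ α) {f : X → ℕ}
    (hf : FinPart f) : AsymptoticallyDetermined (r := r) μ α f := by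
  classical
  let restrictTo (J : Finset ℕ) (x : X) : Option ℕ := if f x ∈ J then some (f x) else none
  have hfin : ∀ J, FinPart (restrictTo J) := fun J =>
    ⟨fun k => hf.isFinPart.1 (MeasurableSet.of_discrete
      (s := (fun i => if i ∈ J then some i else none) ⁻¹' {k})),
      (hf.finite_range.image (fun i => if i ∈ J then some i else none)).subset <| by
        rintro _ ⟨x, rfl⟩
        exact ⟨f x, ⟨x, rfl⟩, rfl⟩⟩
  have hdet : ∀ J, AsymptoticallyDetermined (r := r) μ α (restrictTo J) := by
    intro J
    induction J using Finset.induction_on with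
    | empty => exact const none hmp hα
    | insert i J _ ih =>
      have hi := hf.measurableSet_fiber i
      refine of_factorsThrough hmp hα ((finPart_mem hi).prodMk (hfin J)) (hfin _)
        (prodMk hmp hα (finPart_mem hi) (hfin J) (mem hmp hα hgen hi) ih) fun x y hxy => ?_
      simp only [restrictTo, Prod.mk.injEq, Set.mem_preimage, Set.mem_singleton_iff,
        eq_iff_iff, Finset.mem_insert] at hxy ⊢
      grind
  obtain ⟨A, hA⟩ := hf.exists_finset
  refine of_factorsThrough hmp hα (hfin A) hf (hdet A) fun x y hxy => ?_
  simpa [restrictTo, hA] using hxy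

end AsymptoticallyDetermined

/-- `inf_n F(α^n)` is at most `F(β^j)` when `α` and `β` are generating. -/
lemma exists_Ffun_joinOver_ballFree_le
    (hmp : ∀ g : FreeGroup (Fin r), MeasurePreserving (fun x : X => g • x) μ μ)
    {α β : X → ℕ} (hα : FinPart α) (hβ : FinPart β)
    (hgenα : IsGenerating (FreeGroup (Fin r)) μ α)
    (hgenβ : IsGenerating (FreeGroup (Fin r)) μ β) (j : ℕ) {ε : ℝ} (hε : 0 < ε) :
    ∃ k, Ffun r μ (joinOver (ballFree r k) α) ≤ Ffun r μ (joinOver (ballFree r j) β) + ε := by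
  have hα' : ∀ n, FinPart (joinOver (ballFree r n) α) := fun n =>
    hα.joinOver (fun g => (hmp g).measurable) _
  have hβ' : ∀ n, FinPart (joinOver (ballFree r n) β) := fun n =>
    hβ.joinOver (fun g => (hmp g).measurable) _
  obtain ⟨N, hN⟩ := AsymptoticallyDetermined.of_isGenerating hmp hβ hgenβ (hα' 0) (ε / 2)
    (half_pos hε)
  let m := max N j
  let τ : ℕ → X → ℕ := fun k =>
    joinN (joinOver (ballFree r m) β) (joinOver (ballFree r k) α)
  have hτ : ∀ k, FinPart (τ k) := fun k => (hβ' m).joinN (hα' k)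
  have hτH : ∀ k, entropy μ (τ k) ≤
      entropy μ (fun x => (joinOver (ballFree r m) β x, joinOver (ballFree r k) α x)) := fun k =>
    entropy_le_of_factorsThrough μ (hτ k) ((hβ' m).prodMk (hα' k)) fun x y hxy =>
      joinN_eq_joinN.2 (Prod.mk.inj hxy)
  have hτH' : ∀ k, entropy μ (τ k) ≤
      entropy μ (fun x => (joinOver (ballFree r k) α x, joinOver (ballFree r m) β x)) := fun k =>
    entropy_le_of_factorsThrough μ (hτ k) ((hα' k).prodMk (hβ' m)) fun x y hxy =>
      joinN_eq_joinN.2 (Prod.mk.inj hxy).symm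
  have hδ : 0 < ε / (4 * (r + 1)) := by positivity
  obtain ⟨k, hk⟩ := AsymptoticallyDetermined.of_isGenerating hmp hα hgenα (hβ' m) _ hδ
  refine ⟨k, ?_⟩
  have h1 : Ffun r μ (joinOver (ballFree r m) β) ≤ Ffun r μ (joinOver (ballFree r j) β) :=
    Ffun_joinOver_ballFree_antitone hmp hβ (le_max_right N j)
  have h2 : Ffun r μ (τ 0) ≤ Ffun r μ (joinOver (ballFree r m) β) + ε / 2 := by
    have := Ffun_le_add hmp (hβ' m) (hτ 0) fun x y hxy => (joinN_eq_joinN.1 hxy).1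
    linarith [hτH' 0, hN m (le_max_left N j)]
  have h3 : Ffun r μ (τ k) ≤ Ffun r μ (τ 0) :=
    Ffun_joinN_joinOver_ballFree_antitone hmp (hβ' m) hα k.zero_le
  have hfac : (joinOver (ballFree r k) α).FactorsThrough (τ k) := fun x y hxy =>
    (joinN_eq_joinN.1 hxy).2
  have h4 := Ffun_le_add_mul hmp (hα' k) (hτ k) hfac
  have h5 : (2 * r - 1) * (entropy μ (τ k) - entropy μ (joinOver (ballFree r k) α)) ≤ ε / 2 := by
    have h0 := entropy_le_of_factorsThrough μ (hα' k) (hτ k) hfac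
    calc (2 * r - 1) * (entropy μ (τ k) - entropy μ (joinOver (ballFree r k) α))
        ≤ (2 * (r + 1)) * (ε / (4 * (r + 1))) := by
          gcongr
          · linarith
          · linarith [hτH k, hk k le_rfl]
      _ = ε / 2 := by
          field_simp
          norm_num
  linarith

lemma iInf_Ffun_le
    (hmp : ∀ g : FreeGroup (Fin r), MeasurePreserving (fun x : X => g • x) μ μ)
    {α β : X → ℕ} (hα : FinPart α) (hβ : FinPart β)
    (hgenα : IsGenerating (FreeGroup (Fin r)) μ α)
    (hgenβ : IsGenerating (FreeGroup (Fin r)) μ β) :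
    (⨅ n : ℕ, (Ffun r μ (joinOver (ballFree r n) α) : EReal))
      ≤ ⨅ n : ℕ, (Ffun r μ (joinOver (ballFree r n) β) : EReal) := by
  refine le_iInf fun j => le_of_not_gt fun hlt => ?_
  obtain ⟨c, hc, hc'⟩ := EReal.lt_iff_exists_real_btwn.1 hlt
  rw [EReal.coe_lt_coe_iff] at hc
  obtain ⟨k, hk⟩ := exists_Ffun_joinOver_ballFree_le hmp hα hβ hgenα hgenβ j (sub_pos.2 hc)
  refine ((iInf_le _ k).trans ?_).not_gt hc'
  rw [EReal.coe_le_coe_iff]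
  linarith

end Generating

end Bowen

/-- Theorem 1.3: for the rank `r` free group, `inf_n F(α^n)` does not
depend on the choice of finite generating partition `α`; this common value is Bowen's
`f`-invariant, a measure-conjugacy invariant. -/
theorem f_invariant_well_defined {X : Type*} [MeasurableSpace X] {r : ℕ}
    [MulAction (FreeGroup (Fin r)) X] (μ : Measure X) [IsProbabilityMeasure μ]
    (hmp : ∀ g : FreeGroup (Fin r), MeasurePreserving (fun x : X => g • x) μ μ)
    (α β : X → ℕ) (hα : IsFinPart α) (hβ : IsFinPart β)
    (hgenα : IsGenerating (FreeGroup (Fin r)) μ α)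
    (hgenβ : IsGenerating (FreeGroup (Fin r)) μ β) :
    (⨅ n : ℕ, (Ffun r μ (joinOver (ballFree r n) α) : EReal))
      = ⨅ n : ℕ, (Ffun r μ (joinOver (ballFree r n) β) : EReal) := by
  exact le_antisymm (iInf_Ffun_le hmp hα.finPart hβ.finPart hgenα hgenβ)
    (iInf_Ffun_le hmp hβ.finPart hα.finPart hgenβ hgenα)
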